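/- arXiv:1704.00151 — 2 statements merged into one kernel-verified Lean document; each statement's English description precedes it below -/
import Mathlib

section
/- There is an absolute constant C such that for all y > 0, the sum over primes q > y of 1/φ(ℓ(q)) is at most C / y^{1/4}, where φ is Euler's totient function and ℓ(q) = lcm(q, z(q)). -/
/-- Rank of appearance of `n` in the Fibonacci sequence. -/
noncomputable def zf (n : ℕ) : ℕ := sInf {k | 0 < k ∧ n ∣ Nat.fib k}

noncomputable def ellf (n : ℕ) : ℕ := Nat.lcm n (zf n)

def gf (n : ℕ) : ℕ := Nat.gcd n (Nat.fib n)

def Afib : Set ℕ := {m | ∃ n : ℕ, 0 < n ∧ gf n = m}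

lemma tot_bound (n : ℕ) : n ^ 3 ≤ Nat.totient n ^ 5 * (if 2 ∣ n then 8 else 1) := by
  induction n using Nat.recOnPosPrimePosCoprime with
  | prime_pow p k hp hk =>
    obtain ⟨j, rfl⟩ : ∃ j, k = j + 1 := ⟨k - 1, by omega⟩
    rw [Nat.totient_prime_pow_succ hp]
    have key : p ^ 3 ≤ (p - 1) ^ 5 * (if 2 ∣ p ^ (j + 1) then 8 else 1) := by
      obtain ⟨m, rfl⟩ : ∃ m, p = m + 1 := ⟨p - 1, by have := hp.pos; omega⟩
      have h2 := hp.two_le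
      rcases Nat.lt_or_ge m 2 with h | h
      · have : m = 1 := by omega
        subst this
        have : 2 ∣ (1 + 1) ^ (j + 1) := Dvd.intro_left (2 ^ j) rfl
        simp [this]
      · have h1 : (m + 1) ^ 3 ≤ m ^ 5 := by
          have e : 2 * (m + 1) ≤ 3 * m := by omega
          have e3 := Nat.pow_le_pow_left e 3
          have e4 : 4 * m ^ 3 ≤ m ^ 5 := by
            calc 4 * m ^ 3 ≤ (m * m) * m ^ 3 := by gcongr; nlinarith
              _ = m ^ 5 := by ring
          rw [mul_pow, mul_pow] at e3
          omega
        calc (m + 1) ^ 3 ≤ m ^ 5 * 1 := by omega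
          _ ≤ _ := by
            rw [Nat.add_sub_cancel]
            gcongr
            split_ifs <;> norm_num
    have h1 : 1 ≤ p ^ (2 * j) := Nat.one_le_pow _ _ hp.pos
    calc (p ^ (j + 1)) ^ 3 = p ^ (3 * j) * p ^ 3 * 1 := by ring
      _ ≤ p ^ (3 * j) * ((p - 1) ^ 5 * (if 2 ∣ p ^ (j + 1) then 8 else 1)) * p ^ (2 * j) := by
        gcongr
      _ = _ := by ring
  | zero => simp
  | one => simp
  | coprime a b ha hb hab iha ihb =>
    rw [Nat.totient_mul hab]
    have h := Nat.mul_le_mul iha ihb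
    have hc : (if 2 ∣ a then 8 else 1) * (if 2 ∣ b then 8 else 1) = (if 2 ∣ a * b then 8 else 1) := by
      by_cases h2a : 2 ∣ a <;> by_cases h2b : 2 ∣ b
      · exfalso
        have := Nat.dvd_gcd h2a h2b
        rw [hab] at this
        omega
      · simp [h2a, h2b, Dvd.dvd.mul_right h2a]
      · simp [h2a, h2b, Dvd.dvd.mul_left h2b]
      · have : ¬ 2 ∣ a * b := by rw [Nat.prime_two.dvd_mul]; tauto
        simp only [h2a, h2b, this, if_false]
    rw [← hc]
    calc (a * b) ^ 3 = a ^ 3 * b ^ 3 := by ring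
      _ ≤ _ := h
      _ = _ := by ring

lemma fib_binet {K : Type*} [CommRing K] (a : K) (ha : a ^ 2 = a + 1) (n : ℕ) :
    (Nat.fib n : K) * (a - (1 - a)) = a ^ n - (1 - a) ^ n := by
  induction n using Nat.twoStepInduction with
  | zero => simp
  | one => simp
  | more n h1 h2 =>
    rw [Nat.fib_add_two, Nat.cast_add, add_mul, h1, h2]
    have hb : (1 - a) ^ 2 = (1 - a) + 1 := by linear_combination ha
    rw [pow_add a n 2, pow_add (1 - a) n 2, ha, hb]
    ring

lemma zf_mem {q : ℕ} (h : 0 < zf q) : q ∣ Nat.fib (zf q) := by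
  have hne : {k | 0 < k ∧ q ∣ Nat.fib k}.Nonempty := by
    by_contra hh
    rw [Set.not_nonempty_iff_eq_empty] at hh
    simp [zf, hh] at h
  exact (Nat.sInf_mem hne).2

lemma zf_coprime {q : ℕ} (hq : q.Prime) (h5 : q ≠ 5) (h : 0 < zf q) : Nat.Coprime q (zf q) := by
  rw [hq.coprime_iff_not_dvd]
  rintro ⟨m, hm⟩
  have hd := zf_mem h
  haveI : Fact q.Prime := ⟨hq⟩
  let K := AlgebraicClosure (ZMod q)
  haveI : CharP K q := charP_of_injective_algebraMap (algebraMap (ZMod q) K).injective q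
  obtain ⟨a, ha⟩ : ∃ a : K, a ^ 2 = a + 1 := by
    have hdeg : (Polynomial.X ^ 2 - Polynomial.X - 1 : Polynomial K).degree = 2 := by
      compute_degree!
    obtain ⟨a, ha⟩ := IsAlgClosed.exists_root (Polynomial.X ^ 2 - Polynomial.X - 1 : Polynomial K)
      (by rw [hdeg]; norm_num)
    refine ⟨a, ?_⟩
    simp [Polynomial.IsRoot] at ha
    linear_combination ha
  have hne : a - (1 - a) ≠ 0 := by
    intro h0
    have : ((5 : ℕ) : K) = 0 := by
      push_cast
      linear_combination (a - (1 - a)) * h0 - 4 * ha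
    rw [CharP.cast_eq_zero_iff K q] at this
    exact h5 ((Nat.prime_dvd_prime_iff_eq hq (by norm_num)).1 this)
  have hB := fib_binet a ha (zf q)
  rw [(CharP.cast_eq_zero_iff K q _).2 hd, hm, zero_mul, mul_comm q m, pow_mul, pow_mul,
    ← sub_pow_char] at hB
  have h0 := pow_eq_zero_iff (hq.ne_zero) |>.1 hB.symm
  rw [← fib_binet a ha m] at h0
  have h1 := (mul_eq_zero.1 h0).resolve_right hne
  rw [CharP.cast_eq_zero_iff K q] at h1
  have hmpos : 0 < m := by
    rcases Nat.eq_zero_or_pos m with h' | h'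
    · subst h'; omega
    · exact h'
  have hle : zf q ≤ m := Nat.sInf_le ⟨hmpos, h1⟩
  have := hq.two_le
  nlinarith

lemma fib_le_two_pow' (n : ℕ) : Nat.fib n ≤ 2 ^ n := by
  induction n using Nat.twoStepInduction with
  | zero => simp
  | one => simp
  | more n h1 h2 => rw [Nat.fib_add_two]; rw [pow_succ] at *; rw [pow_succ]; omega

lemma card_fiber (m : ℕ) (hm : 0 < m) (s : Finset ℕ) (hs : ∀ q ∈ s, q.Prime ∧ q ∣ Nat.fib m) :
    s.card ≤ m := by
  have hf : 0 < Nat.fib m := Nat.fib_pos.2 hm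
  have hsub : s ⊆ (Nat.fib m).primeFactors := fun q hq =>
    Nat.mem_primeFactors.2 ⟨(hs q hq).1, (hs q hq).2, hf.ne'⟩
  refine (Finset.card_le_card hsub).trans ?_
  have h1 : 2 ^ (Nat.fib m).primeFactors.card ≤ ∏ p ∈ (Nat.fib m).primeFactors, p :=
    Finset.pow_card_le_prod _ _ _ (fun p hp => (Nat.prime_of_mem_primeFactors hp).two_le)
  have h2 := Nat.le_of_dvd hf (Nat.prod_primeFactors_dvd (Nat.fib m))
  exact (Nat.pow_le_pow_iff_right (by norm_num)).1 ((h1.trans h2).trans (fib_le_two_pow' m))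

open Classical in
lemma summable_h : Summable (fun q : ℕ =>
    if q.Prime ∧ 0 < zf q then ((zf q : ℝ)) ^ (-(21/10) : ℝ) else 0) := by
  have hS : Summable (fun m : ℕ => (m : ℝ) ^ (-(11/10) : ℝ)) :=
    Real.summable_nat_rpow.2 (by norm_num)
  refine summable_of_sum_le (c := ∑' m : ℕ, (m : ℝ) ^ (-(11/10) : ℝ)) ?_ ?_
  · intro q
    dsimp only
    split_ifs <;> positivity
  · intro s
    rw [← Finset.sum_filter]
    set t := s.filter (fun q => q.Prime ∧ 0 < zf q)
    rw [← Finset.sum_fiberwise_of_maps_to (g := zf) (t := t.image zf)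
      (fun q hq => Finset.mem_image_of_mem _ hq)]
    refine le_trans (Finset.sum_le_sum (g := fun m : ℕ => (m : ℝ) ^ (-(11/10) : ℝ)) ?_)
      (hS.sum_le_tsum _ (fun m _ => by positivity))
    intro m hm
    obtain ⟨q0, hq0, rfl⟩ := Finset.mem_image.1 hm
    have hm0 : 0 < zf q0 := (Finset.mem_filter.1 hq0).2.2
    generalize zf q0 = m at *
    have hc := card_fiber m hm0 (t.filter (fun q => zf q = m)) (by
      intro q hq
      obtain ⟨h1, h2⟩ := Finset.mem_filter.1 hq
      obtain ⟨_, h3, h4⟩ := Finset.mem_filter.1 h1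
      exact ⟨h3, h2 ▸ zf_mem h4⟩)
    rw [Finset.sum_congr rfl (g := fun _ => (m : ℝ) ^ (-(21/10) : ℝ))
      (fun q hq => by rw [(Finset.mem_filter.1 hq).2]), Finset.sum_const, nsmul_eq_mul]
    have hmR : (0 : ℝ) < m := by exact_mod_cast hm0
    calc _ ≤ (m : ℝ) * (m : ℝ) ^ (-(21/10) : ℝ) := by gcongr
      _ = (m : ℝ) ^ (1 : ℝ) * (m : ℝ) ^ (-(21/10) : ℝ) := by rw [Real.rpow_one]
      _ = _ := by rw [← Real.rpow_add hmR]; norm_num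

lemma young' (x z : ℝ) (hx : 0 < x) (hz : 0 < z) :
    x ^ (-(3/4) : ℝ) * z ^ (-(3/5) : ℝ) ≤ x ^ (-(21/20) : ℝ) + z ^ (-(21/10) : ℝ) := by
  have h := Real.geom_mean_le_arith_mean2_weighted (w₁ := 5/7) (w₂ := 2/7)
    (p₁ := x ^ (-(21/20) : ℝ)) (p₂ := z ^ (-(21/10) : ℝ))
    (by norm_num) (by norm_num) (by positivity) (by positivity) (by norm_num)
  rw [← Real.rpow_mul hx.le, ← Real.rpow_mul hz.le] at h
  norm_num at h ⊢
  have h1 : 0 < x ^ (-(21/20) : ℝ) := by positivity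
  have h2 : 0 < z ^ (-(21/10) : ℝ) := by positivity
  linarith

lemma tot_real (z : ℕ) (hz : 0 < z) : (z : ℝ) ^ (3/5 : ℝ) ≤ 2 * (Nat.totient z : ℝ) := by
  have h : z ^ 3 ≤ (2 * Nat.totient z) ^ 5 := by
    refine (tot_bound z).trans ?_
    rw [mul_pow, mul_comm]
    gcongr
    split_ifs <;> norm_num
  have hR : (z : ℝ) ^ 3 ≤ (2 * (Nat.totient z : ℝ)) ^ 5 := by exact_mod_cast h
  have h2 := Real.rpow_le_rpow (by positivity) hR (z := 1/5) (by norm_num)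
  rw [← Real.rpow_natCast, ← Real.rpow_natCast, ← Real.rpow_mul (by positivity),
    ← Real.rpow_mul (by positivity)] at h2
  norm_num at h2
  exact h2

open Classical in
lemma term_bound (y : ℝ) (hy : 0 < y) (q : ℕ) :
    (if q.Prime ∧ y < (q : ℝ) then 1 / (Nat.totient (ellf q) : ℝ) else 0) ≤
      (4 / y ^ ((1 : ℝ) / 4)) * ((q : ℝ) ^ (-(21/20) : ℝ) +
        (if q.Prime ∧ 0 < zf q then ((zf q : ℝ)) ^ (-(21/10) : ℝ) else 0) +
        (if q = 5 then 1 else 0)) := by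
  have hnn : (0 : ℝ) ≤ (if q.Prime ∧ 0 < zf q then ((zf q : ℝ)) ^ (-(21/10) : ℝ) else 0) := by
    split_ifs <;> positivity
  have hnn2 : (0 : ℝ) ≤ (q : ℝ) ^ (-(21/20) : ℝ) := by positivity
  have hyp : 0 < y ^ ((1 : ℝ) / 4) := by positivity
  by_cases hq : q.Prime ∧ y < (q : ℝ)
  swap
  · rw [if_neg hq]
    have : (0 : ℝ) ≤ (if q = 5 then 1 else 0) := by split_ifs <;> norm_num
    positivity
  rw [if_pos hq]
  obtain ⟨hp, hyq⟩ := hq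
  have hq0 : (0 : ℝ) < q := by exact_mod_cast hp.pos
  by_cases h5 : q = 5
  · rw [if_pos h5]
    have hy4 : y ^ ((1 : ℝ) / 4) ≤ 4 := by
      have : y ≤ 4 ^ (4 : ℝ) := by subst h5; norm_num at hyq ⊢; linarith
      have h2 := Real.rpow_le_rpow hy.le this (z := 1/4) (by norm_num)
      rw [← Real.rpow_mul (by norm_num)] at h2
      norm_num at h2 ⊢
      exact h2
    have h1 : 1 ≤ 4 / y ^ ((1 : ℝ) / 4) := by rw [le_div_iff₀ hyp]; linarith
    have h3 : 1 / (Nat.totient (ellf q) : ℝ) ≤ 1 := by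
      rcases Nat.eq_zero_or_pos (Nat.totient (ellf q)) with h | h
      · rw [h]; norm_num
      · have : (1 : ℝ) ≤ Nat.totient (ellf q) := by exact_mod_cast h
        rw [div_le_one (by linarith)]; exact this
    nlinarith
  rw [if_neg h5, add_zero]
  rcases Nat.eq_zero_or_pos (zf q) with hz | hz
  · have : ellf q = 0 := by simp [ellf, hz]
    rw [this]
    simp only [Nat.totient_zero, Nat.cast_zero, div_zero]
    positivity
  rw [if_pos ⟨hp, hz⟩]
  have hco := zf_coprime hp h5 hz
  have hell : Nat.totient (ellf q) = (q - 1) * Nat.totient (zf q) := by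
    rw [ellf, hco.lcm_eq_mul, Nat.totient_mul hco, Nat.totient_prime hp]
  have hzR : (0 : ℝ) < zf q := by exact_mod_cast hz
  have ht := tot_real (zf q) hz
  have hq1 : (q : ℝ) ≤ 2 * ((q - 1 : ℕ) : ℝ) := by
    have := hp.two_le
    have : q ≤ 2 * (q - 1) := by omega
    exact_mod_cast this
  have hlow : (q : ℝ) * (zf q : ℝ) ^ (3/5 : ℝ) ≤ 4 * (Nat.totient (ellf q) : ℝ) := by
    rw [hell, Nat.cast_mul]
    calc _ ≤ (2 * ((q - 1 : ℕ) : ℝ)) * (2 * (Nat.totient (zf q) : ℝ)) := by gcongr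
      _ = _ := by ring
  have hpos : 0 < (q : ℝ) * (zf q : ℝ) ^ (3/5 : ℝ) := by positivity
  have hT : 0 < (Nat.totient (ellf q) : ℝ) := by linarith
  calc 1 / (Nat.totient (ellf q) : ℝ) ≤ 4 / ((q : ℝ) * (zf q : ℝ) ^ (3/5 : ℝ)) := by
        rw [div_le_div_iff₀ hT hpos]; linarith
    _ = 4 / (q : ℝ) ^ ((1 : ℝ)/4) * ((q : ℝ) ^ (-(3/4) : ℝ) * (zf q : ℝ) ^ (-(3/5) : ℝ)) := by
        rw [Real.rpow_neg hq0.le, Real.rpow_neg hzR.le]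
        have : (q : ℝ) = (q : ℝ) ^ ((1 : ℝ)/4) * (q : ℝ) ^ ((3 : ℝ)/4) := by
          rw [← Real.rpow_add hq0]; norm_num
        nth_rewrite 1 [this]
        field_simp
    _ ≤ 4 / y ^ ((1 : ℝ)/4) * ((q : ℝ) ^ (-(21/20) : ℝ) + (zf q : ℝ) ^ (-(21/10) : ℝ)) := by
        gcongr
        exact young' _ _ hq0 hzR

theorem stmt12 :
    ∃ C : ℝ, 0 < C ∧ ∀ y : ℝ, 0 < y →
      (∑' q : ℕ, if q.Prime ∧ y < (q : ℝ) then 1 / (Nat.totient (ellf q) : ℝ) else 0) ≤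
        C / y ^ ((1 : ℝ) / 4) := by
  classical
  have hG : Summable (fun q : ℕ => (q : ℝ) ^ (-(21/20) : ℝ) +
        (if q.Prime ∧ 0 < zf q then ((zf q : ℝ)) ^ (-(21/10) : ℝ) else 0) +
        (if q = 5 then (1 : ℝ) else 0)) := by
    refine ((Real.summable_nat_rpow.2 (by norm_num)).add ?_).add ?_
    · convert summable_h
    · exact (hasSum_ite_eq 5 (1 : ℝ)).summable
  set G := (fun q : ℕ => (q : ℝ) ^ (-(21/20) : ℝ) +
        (if q.Prime ∧ 0 < zf q then ((zf q : ℝ)) ^ (-(21/10) : ℝ) else 0) +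
        (if q = 5 then (1 : ℝ) else 0)) with hGdef
  have hG0 : ∀ q, 0 ≤ G q := by
    intro q
    simp only [hGdef]
    have h1 : (0 : ℝ) ≤ (if q.Prime ∧ 0 < zf q then ((zf q : ℝ)) ^ (-(21/10) : ℝ) else 0) := by
      split_ifs <;> positivity
    have h2 : (0 : ℝ) ≤ (if q = 5 then 1 else 0) := by split_ifs <;> norm_num
    positivity
  have hS0 : 0 ≤ ∑' q, G q := tsum_nonneg hG0
  refine ⟨4 * (∑' q, G q) + 1, by positivity, fun y hy => ?_⟩
  have hyp : 0 < y ^ ((1 : ℝ) / 4) := by positivity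
  have hb : ∀ q : ℕ, (if q.Prime ∧ y < (q : ℝ) then 1 / (Nat.totient (ellf q) : ℝ) else 0) ≤
      (4 / y ^ ((1 : ℝ) / 4)) * G q := by
    intro q
    convert term_bound y hy q
  have hsum := hG.mul_left (4 / y ^ ((1 : ℝ) / 4))
  have hle := (Summable.of_nonneg_of_le (fun q => by split_ifs <;> positivity) hb hsum).tsum_le_tsum
    hb hsum
  refine hle.trans ?_
  rw [tsum_mul_left, div_mul_eq_mul_div]
  gcongr
  linarith
end

section
/- The set 𝒜 = {gcd(n, F_n) : n ≥ 1} has asymptotic density zero: #(𝒜 ∩ [1, x]) / x → 0 as x → ∞. -/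
lemma fibA_cassini (j : ℕ) :
    ((Nat.fib (j+1) : ℤ))^2 - Nat.fib j * Nat.fib (j+1) - (Nat.fib j : ℤ)^2 = (-1)^j := by
  induction j with
  | zero => simp
  | succ k ih =>
    rw [show k + 1 + 1 = k + 2 from rfl, Nat.fib_add_two]
    push_cast
    rw [pow_succ (-1 : ℤ), ← ih]; ring

lemma fibA_shift {m n : ℕ} (h : m ∣ Nat.fib n) (i : ℕ) :
    (Nat.fib (i + n) : ZMod m) = Nat.fib i * Nat.fib (n+1) := by
  have h0 : (Nat.fib n : ZMod m) = 0 := (ZMod.natCast_eq_zero_iff _ _).2 h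
  cases i with
  | zero => simp [h0]
  | succ i =>
    rw [show i + 1 + n = i + n + 1 by ring, Nat.fib_add]
    push_cast
    rw [h0]; ring

lemma fibA_c4 {m n : ℕ} (h : m ∣ Nat.fib n) : (Nat.fib (n+1) : ZMod m)^4 = 1 := by
  have h0 : (Nat.fib n : ZMod m) = 0 := (ZMod.natCast_eq_zero_iff _ _).2 h
  have := congrArg (Int.cast : ℤ → ZMod m) (fibA_cassini n)
  push_cast at this
  rw [h0] at this
  have h2 : (Nat.fib (n+1) : ZMod m)^2 = (-1)^n := by linear_combination this
  calc (Nat.fib (n+1) : ZMod m)^4 = ((Nat.fib (n+1) : ZMod m)^2)^2 := by ring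
    _ = 1 := by rw [h2, ← pow_mul, mul_comm, pow_mul]; simp

lemma fibA_per {m n : ℕ} (h : m ∣ Nat.fib n) (i : ℕ) :
    (Nat.fib (i + 4 * n) : ZMod m) = Nat.fib i := by
  rw [show i + 4 * n = i + n + n + n + n by ring]
  rw [fibA_shift h, fibA_shift h, fibA_shift h, fibA_shift h]
  have := fibA_c4 h
  linear_combination (Nat.fib i : ZMod m) * this

lemma fibA_root {m n : ℕ} (h : m ∣ Nat.fib n) (h3 : ¬ 3 ∣ n) :
    ∃ t : ZMod m, t^3 + 3 * t - 1 = 0 := by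
  obtain ⟨j, hj, hodd⟩ : ∃ j, (3 * j = 1 + 4 * n ∨ 3 * j = 1 + 4 * n + 4 * n) ∧ Odd j := by
    have : n % 3 = 1 ∨ n % 3 = 2 := by omega
    rcases this with h1 | h1
    · refine ⟨(1 + 4 * n + 4 * n) / 3, Or.inr (by omega), ?_⟩
      rw [Nat.odd_iff]; omega
    · refine ⟨(1 + 4 * n) / 3, Or.inl (by omega), ?_⟩
      rw [Nat.odd_iff]; omega
  have hc := congrArg (Int.cast : ℤ → ZMod m) (fibA_cassini j)
  push_cast at hc
  rw [hodd.neg_one_pow] at hc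
  have e1 : (Nat.fib (3 * j + 1) : ZMod m) = 1 := by
    rcases hj with hj | hj
    · rw [hj, show 1 + 4 * n + 1 = 2 + 4 * n by ring, fibA_per h]; simp
    · rw [hj, show 1 + 4 * n + 4 * n + 1 = 2 + 4 * n + 4 * n by ring, fibA_per h, fibA_per h]; simp
  have e2 : (Nat.fib (3 * j + 2) : ZMod m) = 2 := by
    have : Nat.fib 3 = 2 := by decide
    rcases hj with hj | hj
    · rw [hj, show 1 + 4 * n + 2 = 3 + 4 * n by ring, fibA_per h, this]; simp
    · rw [hj, show 1 + 4 * n + 4 * n + 2 = 3 + 4 * n + 4 * n by ring, fibA_per h, fibA_per h, this]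
      simp
  have f2 : (Nat.fib (2 * j + 1) : ZMod m) = (Nat.fib (j+1))^2 + (Nat.fib j)^2 := by
    rw [Nat.fib_two_mul_add_one]; push_cast; ring
  have f2' : (Nat.fib (2 * j + 2) : ZMod m) = Nat.fib (j+1) * (2 * Nat.fib j + Nat.fib (j+1)) := by
    rw [Nat.fib_two_mul_add_two]; push_cast; ring
  have f0 : (Nat.fib (2 * j) : ZMod m) = Nat.fib (2 * j + 2) - Nat.fib (2 * j + 1) := by
    rw [Nat.fib_add_two]; push_cast; ring
  have g1 : (Nat.fib (3 * j + 1) : ZMod m) =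
      Nat.fib (2*j) * Nat.fib j + Nat.fib (2*j+1) * Nat.fib (j+1) := by
    rw [show 3 * j + 1 = 2 * j + j + 1 by ring, Nat.fib_add]; push_cast; ring
  have g2 : (Nat.fib (3 * j + 2) : ZMod m) =
      Nat.fib (2*j) * Nat.fib (j+1) + Nat.fib (2*j+1) * (Nat.fib j + Nat.fib (j+1)) := by
    rw [show 3 * j + 2 = 2 * j + (j + 1) + 1 by ring, Nat.fib_add, Nat.fib_add_two]; push_cast; ring
  rw [e1, f0, f2, f2'] at g1
  rw [e2, f0, f2, f2'] at g2
  refine ⟨2 * Nat.fib (j+1) - Nat.fib j, ?_⟩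
  generalize (Nat.fib j : ZMod m) = a at *
  generalize (Nat.fib (j+1) : ZMod m) = b at *
  linear_combination 3 * (2 * b - a) * hc - 3 * g1 + g2

lemma fibA_two_pow (K : ℕ) : 2^(K+1) ∣ Nat.fib (3 * 2^K) := by
  induction K with
  | zero => decide
  | succ K ih =>
    rw [show 3 * 2^(K+1) = 2 * (3 * 2^K) by ring, Nat.fib_two_mul, pow_succ]
    apply mul_dvd_mul ih
    have : 2 ∣ Nat.fib (3 * 2^K) := (dvd_pow_self 2 (by omega)).trans ih
    omega

lemma fibA_ns5 : ¬ IsSquare (2 : ZMod 5) := by decide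

/-- primes `≡ 2 mod 5`, `≡ -1 mod 2^K`. -/
lemma fibA_two_adic {p K n : ℕ} (hK : 2 ≤ K) (hp : p.Prime) (h5 : p % 5 = 2) (h2 : 2^K ∣ p + 1)
    (hn : p ∣ Nat.fib n) : 2^K ∣ n := by
  have := Fact.mk hp
  have h4 : 4 ∣ p + 1 := by
    refine Dvd.dvd.trans ?_ h2
    exact (pow_dvd_pow 2 hK)
  have hp2 : p ≠ 2 := by omega
  have hns : ¬ IsSquare (5 : ZMod p) := by
    have : Fact (Nat.Prime 5) := ⟨by norm_num⟩
    have := ZMod.exists_sq_eq_prime_iff_of_mod_four_eq_one (p := 5) (q := p) (by norm_num) hp2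
    push_cast at this
    rw [← this]
    have : (p : ZMod 5) = 2 := by
      have := (ZMod.natCast_eq_natCast_iff' p 2 5).2 (by omega)
      simpa using this
    rw [this]; exact fibA_ns5
  let L := AlgebraicClosure (ZMod p)
  have : CharP L p := charP_of_injective_algebraMap (algebraMap (ZMod p) L).injective p
  have : ExpChar L p := ExpChar.prime hp
  obtain ⟨α, hα⟩ : ∃ α : L, α^2 - α - 1 = 0 := by
    obtain ⟨s, hs⟩ := IsAlgClosed.exists_pow_nat_eq (5 : L) (n := 2) (by norm_num)
    have h20 : (2 : L) ≠ 0 := by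
      intro h
      have : ((2 : ℕ) : L) = 0 := by exact_mod_cast h
      rw [CharP.cast_eq_zero_iff L p] at this
      have := (Nat.prime_dvd_prime_iff_eq hp Nat.prime_two).1 this
      exact hp2 this
    refine ⟨(1 + s) / 2, ?_⟩
    have h2i : (2 : L) * 2⁻¹ = 1 := mul_inv_cancel₀ h20
    have : (4 : L) * (((1 + s) / 2)^2 - (1 + s) / 2 - 1) = 0 := by
      rw [div_eq_mul_inv]
      linear_combination hs + ((1 + s)^2 * (2 * 2⁻¹ + 1) - 2 * (1 + s)) * h2i
    have h40 : (4 : L) ≠ 0 := by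
      rw [show (4 : L) = 2 * 2 by norm_num]; exact mul_ne_zero h20 h20
    exact (mul_eq_zero.1 this).resolve_left h40
  have hnot : ∀ c : ZMod p, algebraMap (ZMod p) L c ≠ α := by
    intro c hc
    apply hns
    have : c^2 - c - 1 = 0 := by
      apply (algebraMap (ZMod p) L).injective
      simp only [map_sub, map_pow, map_one, map_zero, hc, hα]
    exact ⟨2 * c - 1, by linear_combination (-4) * this⟩
  have hfrob : α^p ≠ α := by
    intro h
    obtain ⟨c, hc⟩ := (mem_bot_iff_intCast p L).1 ((Subfield.mem_bot_iff_pow_eq_self L p).2 h)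
    exact hnot c (by simpa using hc)
  have hαp : (α^p)^2 - α^p - 1 = 0 := by
    have := congrArg (frobenius L p) hα
    simp only [map_sub, map_pow, map_one, map_zero, frobenius_def] at this
    exact this
  have hsum : α^p + α = 1 := by
    have : (α^p - α) * (α^p + α - 1) = 0 := by linear_combination hαp - hα
    rcases mul_eq_zero.1 this with h | h
    · exact absurd (sub_eq_zero.1 h) hfrob
    · linear_combination h
  have hnorm : α^(p+1) = -1 := by
    rw [pow_succ]; linear_combination α * hsum - hα
  have hpow : ∀ i, α^(i+1) = Nat.fib (i+1) * α + Nat.fib i := by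
    intro i
    induction i with
    | zero => simp
    | succ i ih =>
      rw [pow_succ, ih, show i + 1 + 1 = i + 2 from rfl, Nat.fib_add_two]; push_cast
      linear_combination (Nat.fib (i+1) : L) * hα
  have hF : p ∣ Nat.fib (p+1) := by
    rw [← ZMod.natCast_eq_zero_iff]
    by_contra hne
    have := hpow p
    rw [hnorm] at this
    apply hnot ((-1 - Nat.fib p) / Nat.fib (p+1))
    have hne' : (Nat.fib (p+1) : L) ≠ 0 := by
      intro h
      apply hne
      apply (algebraMap (ZMod p) L).injective
      simpa using h
    simp only [map_div₀, map_sub, map_neg, map_one, map_natCast]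
    rw [div_eq_iff hne']
    linear_combination this
  by_contra hcon
  have hg : p ∣ Nat.fib (Nat.gcd n (p+1)) := by
    rw [Nat.fib_gcd]; exact Nat.dvd_gcd hn hF
  set h := (p+1)/2 with hh
  have hhp : 2 * h = p + 1 := by omega
  have hgd : Nat.gcd n (p+1) ∣ h := by
    obtain ⟨e, he⟩ := Nat.gcd_dvd_right n (p+1)
    by_cases hev : 2 ∣ e
    · obtain ⟨e', rfl⟩ := hev
      refine ⟨e', ?_⟩
      have : 2 * h = 2 * (Nat.gcd n (p+1) * e') := by rw [hhp]; nth_rewrite 1 [he]; ring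
      omega
    · exfalso
      apply hcon
      refine Dvd.dvd.trans ?_ (Nat.gcd_dvd_left n (p+1))
      apply Nat.Coprime.dvd_of_dvd_mul_right (k := 2^K) (n := e)
      · apply Nat.Coprime.pow_left
        exact (Nat.coprime_primes Nat.prime_two Nat.prime_two |>.not.2 (by simp) |> fun _ => (Nat.prime_two.coprime_iff_not_dvd.2 hev))
      · rw [← he]; exact h2
  have hfh : p ∣ Nat.fib h := hg.trans (Nat.fib_dvd _ _ hgd)
  obtain ⟨i, hi⟩ : ∃ i, h = i + 1 := ⟨h - 1, by omega⟩
  have h1 := hpow i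
  rw [← hi] at h1
  have h0 : (Nat.fib h : L) = 0 := by
    rw [CharP.cast_eq_zero_iff L p]; exact hfh
  rw [h0] at h1
  have h3 : (Nat.fib i : ZMod p)^2 = -1 := by
    apply (algebraMap (ZMod p) L).injective
    simp only [map_pow, map_natCast, map_neg, map_one]
    rw [← hnorm, ← hhp, mul_comm, pow_mul, h1]; ring
  have := ZMod.mod_four_ne_three_of_sq_eq_neg_one h3
  omega


noncomputable def rhoA (m : ℕ) : ℕ := Nat.card {t : ZMod m // t^3 + 3 * t - 1 = 0}

lemma rhoA_mul {a b : ℕ} (h : Nat.Coprime a b) : rhoA (a * b) = rhoA a * rhoA b := by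
  unfold rhoA
  rw [← Nat.card_prod]
  let e := ZMod.chineseRemainder h
  refine Nat.card_congr ((e.toEquiv.subtypeEquiv (q := fun x : ZMod a × ZMod b =>
    x.1^3 + 3 * x.1 - 1 = 0 ∧ x.2^3 + 3 * x.2 - 1 = 0) ?_).trans (Equiv.subtypeProdEquivProd
      (p := fun t : ZMod a => t^3 + 3 * t - 1 = 0) (q := fun t : ZMod b => t^3 + 3 * t - 1 = 0)))
  intro t
  have : e (t^3 + 3 * t - 1) = (e t)^3 + 3 * (e t) - 1 := by
    rw [map_sub, map_add, map_pow, map_mul, map_one, map_ofNat]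
  rw [← map_eq_zero_iff e e.injective, this, Prod.ext_iff]
  simp

lemma sqrtA_prime {p : ℕ} (hp : p.Prime) (h15 : p % 15 = 1) : ∃ s : ZMod p, s^2 = -15 := by
  have := Fact.mk hp
  have hp2 : p ≠ 2 := by rintro rfl; omega
  obtain ⟨r, hr⟩ : IsSquare (5 : ZMod p) := by
    have : Fact (Nat.Prime 5) := ⟨by norm_num⟩
    have := ZMod.exists_sq_eq_prime_iff_of_mod_four_eq_one (p := 5) (q := p) (by norm_num) hp2
    push_cast at this
    rw [← this]
    have : (p : ZMod 5) = 1 := by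
      have := (ZMod.natCast_eq_natCast_iff' p 1 5).2 (by omega)
      simpa using this
    rw [this]; exact ⟨1, by simp⟩
  obtain ⟨w, hw⟩ : ∃ w : (ZMod p)ˣ, orderOf w = 3 := by
    have : Fact (Nat.Prime 3) := ⟨by norm_num⟩
    apply exists_prime_orderOf_dvd_card
    rw [ZMod.card_units]; omega
  have hw1 : (w : ZMod p) ≠ 1 := by
    intro h
    have : w = 1 := by ext; simpa using h
    rw [this] at hw; simp at hw
  have hw3 : (w : ZMod p)^3 = 1 := by
    have := pow_orderOf_eq_one w
    rw [hw] at this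
    have := congrArg Units.val this
    simpa using this
  have hq : (w : ZMod p)^2 + w + 1 = 0 := by
    have : ((w : ZMod p) - 1) * ((w : ZMod p)^2 + w + 1) = 0 := by linear_combination hw3
    exact (mul_eq_zero.1 this).resolve_left (sub_ne_zero.2 hw1)
  exact ⟨(2 * w + 1) * r, by linear_combination (-(2 * (w : ZMod p) + 1)^2) * hr + 20 * hq⟩

lemma unitA {p n : ℕ} (hp : p.Prime) {k : ℕ} (hk : ¬ p ∣ k) : IsUnit ((k : ℕ) : ZMod (p^n)) := by
  rw [ZMod.isUnit_iff_coprime]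
  exact (Nat.Coprime.pow_left n ((Nat.Prime.coprime_iff_not_dvd hp).2 hk)).symm

lemma sqrtA_pow {p : ℕ} (hp : p.Prime) (h15 : p % 15 = 1) (n : ℕ) :
    ∃ s : ZMod (p^(n+1)), s^2 = -15 := by
  obtain ⟨s0, hs0⟩ := sqrtA_prime hp h15
  obtain ⟨z, rfl⟩ := ZMod.intCast_surjective s0
  have hd : (p : ℤ) ∣ z^2 - (-15) := by
    rw [← ZMod.intCast_zmod_eq_zero_iff_dvd]; push_cast; rw [hs0]; ring
  have h1 := dvd_sub_pow_of_dvd_sub hd n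
  have h2 : ((z : ZMod (p^(n+1)))^2)^(p^n) = (-15)^(p^n) := by
    have h1' : ((p^(n+1) : ℕ) : ℤ) ∣ (z^2)^p^n - (-15)^p^n := by exact_mod_cast h1
    rw [← ZMod.intCast_zmod_eq_zero_iff_dvd] at h1'
    push_cast at h1'
    exact sub_eq_zero.1 h1'
  have hpo : Odd p := hp.odd_of_ne_two (by rintro rfl; omega)
  obtain ⟨e, he⟩ : Odd (p^n) := hpo.pow
  have hu : IsUnit (-15 : ZMod (p^(n+1))) := by
    have := (unitA (n := n+1) hp (k := 15) (by
      intro h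
      have := Nat.le_of_dvd (by norm_num) h
      have h' := hp.one_lt
      omega)).neg
    simpa using this
  obtain ⟨v, hv⟩ := hu
  refine ⟨z^(p^n) * ((v⁻¹ ^ e : (ZMod (p^(n+1)))ˣ) : ZMod (p^(n+1))), ?_⟩
  have h3 : ((z : ZMod (p^(n+1)))^(p^n)) ^ 2 = v^(2 * e + 1) := by
    rw [pow_right_comm, h2, hv, he]
  rw [mul_pow, ← hv]
  rw [h3, ← Units.val_pow_eq_pow_val, ← Units.val_pow_eq_pow_val, ← Units.val_mul]
  congr 1
  rw [inv_pow, inv_pow, mul_inv_eq_iff_eq_mul, ← pow_mul, ← pow_succ']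
  congr 1
  omega

lemma rhoA_three {p : ℕ} (hp : p.Prime) (h15 : p % 15 = 1) {n : ℕ} (hn : 0 < n)
    (h1 : 1 ≤ rhoA (p^n)) : 3 ≤ rhoA (p^n) := by
  obtain ⟨n, rfl⟩ : ∃ k, n = k + 1 := ⟨n - 1, by omega⟩
  have hp0 : NeZero (p^(n+1)) := ⟨(pow_pos hp.pos _).ne'⟩
  have hp1 : Fact (1 < p^(n+1)) := ⟨Nat.one_lt_pow (by omega) hp.one_lt⟩
  obtain ⟨s, hs⟩ := sqrtA_pow hp h15 n
  unfold rhoA at *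
  obtain ⟨⟨t, ht⟩⟩ : Nonempty {t : ZMod (p^(n+1)) // t^3 + 3 * t - 1 = 0} := by
    by_contra hne
    rw [not_nonempty_iff] at hne
    simp at h1
  have hbig : 16 ≤ p := by
    have := hp.one_lt
    by_contra hlt
    interval_cases p <;> omega
  have u2 : IsUnit (2 : ZMod (p^(n+1))) := by
    simpa using unitA (n := n+1) hp (k := 2) (fun h => by have := Nat.le_of_dvd (by norm_num) h; omega)
  have u15 : IsUnit (15 : ZMod (p^(n+1))) := by
    simpa using unitA (n := n+1) hp (k := 15) (fun h => by have := Nat.le_of_dvd (by norm_num) h; omega)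
  have hk : (t^2+1)^2 * (t^2+4) = 5 := by linear_combination (t^3 + 3 * t + 1) * ht
  have u3t : IsUnit (3 * (t^2+1)) := by
    apply isUnit_of_mul_isUnit_left (y := (t^2+1) * (t^2+4))
    rw [show 3 * (t^2+1) * ((t^2+1) * (t^2+4)) = 15 by linear_combination 3 * hk]
    exact u15
  have ut : IsUnit (t^2+1) := isUnit_of_mul_isUnit_right u3t
  obtain ⟨i, hi⟩ := ut.exists_right_inv
  obtain ⟨h, hh⟩ := u2.exists_right_inv
  have hu : (s * i)^2 = -3 * (t^2+4) := by
    linear_combination i^2 * hs + 3 * i^2 * hk - 3 * (t^2+4) * ((t^2+1)*i + 1) * hi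
  have quad : ∀ u : ZMod (p^(n+1)), u^2 = -3 * (t^2+4) →
      ((-t + u) * h)^2 + t * ((-t+u)*h) + t^2 + 3 = 0 := by
    intro u hu
    have : (2:ZMod (p^(n+1)))^2 * (((-t + u) * h)^2 + t * ((-t+u)*h) + t^2 + 3) = 0 := by
      linear_combination ((-t+u)^2 * (2 * h + 1) + 2 * t * (-t+u)) * hh + hu
    exact (u2.pow 2).mul_right_eq_zero.1 this
  have root : ∀ x : ZMod (p^(n+1)), x^2 + t * x + t^2 + 3 = 0 → x^3 + 3 * x - 1 = 0 := by
    intro x hx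
    linear_combination (x - t) * hx + ht
  have hne : ∀ x : ZMod (p^(n+1)), x^2 + t * x + t^2 + 3 = 0 → t ≠ x := by
    rintro x hx rfl
    apply u3t.ne_zero
    linear_combination hx
  have q1 := quad (s*i) hu
  have q2 := quad (-(s*i)) (by rw [neg_sq, hu])
  have hne2 : (-t + s*i)*h ≠ (-t + -(s*i))*h := by
    intro heq
    have hs0 : s * i = 0 := by
      linear_combination heq - s * i * hh
    have : s = 0 := by linear_combination (t^2+1) * hs0 - s * hi
    apply u15.ne_zero
    rw [this] at hs
    linear_combination hs
  have hinj : Function.Injective (![⟨t, ht⟩, ⟨_, root _ q1⟩, ⟨_, root _ q2⟩] :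
      Fin 3 → {t : ZMod (p^(n+1)) // t^3 + 3 * t - 1 = 0}) := by
    intro a b hab
    have n1 := hne _ q1
    have n2 := hne _ q2
    fin_cases a <;> fin_cases b <;> simp only [Subtype.ext_iff] at hab <;> first | rfl | (exfalso; revert hab; first | exact n1 | exact n2 | exact n1.symm | exact n2.symm | exact hne2 | exact hne2.symm)
  have := Nat.card_le_card_of_injective _ hinj
  simpa using this

lemma rhoA_lower (m : ℕ) (hm : 0 < m) (h1 : 1 ≤ rhoA m) :
    3 ^ (m.primeFactors.filter (fun p => p % 15 = 1)).card ≤ rhoA m := by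
  induction m using Nat.recOnPosPrimePosCoprime with
  | zero => omega
  | one => simpa using h1
  | prime_pow p n hp hn =>
    rw [Nat.primeFactors_prime_pow hn.ne' hp, Finset.filter_singleton]
    split_ifs with h
    · simpa using rhoA_three hp h hn h1
    · simpa using h1
  | coprime a b ha hb hab iha ihb =>
    rw [rhoA_mul hab] at h1 ⊢
    have h1a : 1 ≤ rhoA a := Nat.pos_of_ne_zero (by rintro h; simp [h] at h1)
    have h1b : 1 ≤ rhoA b := Nat.pos_of_ne_zero (by rintro h; simp [h] at h1)
    rw [hab.primeFactors_mul, Finset.filter_union, Finset.card_union_of_disjoint, pow_add]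
    · exact Nat.mul_le_mul (iha (by omega) h1a) (ihb (by omega) h1b)
    · exact Finset.disjoint_filter_filter hab.disjoint_primeFactors


open ArithmeticFunction ArithmeticFunction.vonMangoldt in
lemma primesA_not_summable {q : ℕ} [NeZero q] {a : ZMod q} (ha : IsUnit a) :
    ¬ Summable (Set.indicator {p : ℕ | p.Prime ∧ (p : ZMod q) = a} (fun n : ℕ => (1 : ℝ) / n)) := by
  classical
  intro H
  set S := {p : ℕ | p.Prime ∧ (p : ZMod q) = a} with hS
  set g := Set.indicator S (fun n : ℕ => (1 : ℝ) / n) with hg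
  have hg0 : ∀ n, 0 ≤ g n := fun n => Set.indicator_nonneg (fun _ _ => by positivity) _
  obtain ⟨C, hC⟩ := LSeries_residueClass_lower_bound ha
  have hc : 0 < (q.totient : ℝ)⁻¹ := inv_pos.mpr (mod_cast q.totient.pos_of_neZero)
  set c := (q.totient : ℝ)⁻¹ with hcdef
  have htail := tendsto_tsum_compl_atTop_zero g
  obtain ⟨s, hs⟩ := (htail.eventually (gt_mem_nhds (half_pos hc))).exists
  let tl : ℕ → ℝ := Set.indicator {x | x ∉ s} g
  have htl_eq : ∑' n, tl n < c / 2 := by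
    have : ∑' n, tl n = ∑' (a : { x // x ∉ s }), g a := (tsum_subtype {x | x ∉ s} g).symm
    rw [this]; exact hs
  have htl : Summable tl := H.indicator _
  let B : ℕ → ℝ := Set.indicator (s : Set ℕ) (fun n => residueClass a n / n)
  have hB : Summable B := by
    apply summable_of_ne_finset_zero (s := s)
    intro b hb
    exact Set.indicator_of_notMem (by simpa using hb) _
  have hA := (summable_residueClass_non_primes_div a).add hB
  set A : ℕ → ℝ := fun n => (if n.Prime then 0 else residueClass a n) / n + B n with hAdef
  have key : ∀ x : ℝ, 1 < x → ∀ n : ℕ, residueClass a n / (n : ℝ)^x ≤ A n + (x - 1)⁻¹ * tl n := by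
    intro x hx n
    have hx1 : 0 < x - 1 := by linarith
    have hr := residueClass_nonneg a n
    have htl0 : 0 ≤ tl n := Set.indicator_nonneg (fun _ _ => hg0 _) _
    have hB0 : 0 ≤ B n := Set.indicator_nonneg (fun k _ => div_nonneg (residueClass_nonneg a k) (by positivity)) _
    rcases Nat.eq_zero_or_pos n with rfl | hn
    · have h0 : residueClass a 0 = 0 := residueClass_apply_zero a
      rw [h0, zero_div]
      have : A 0 = B 0 := by simp [hAdef]
      rw [this]; positivity
    have hn1 : (1 : ℝ) ≤ n := by exact_mod_cast hn
    have hle : residueClass a n / (n : ℝ)^x ≤ residueClass a n / n := by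
      apply div_le_div_of_nonneg_left hr (by positivity)
      conv_lhs => rw [← Real.rpow_one (n : ℝ)]
      exact Real.rpow_le_rpow_of_exponent_le hn1 hx.le
    by_cases hp : n.Prime
    · by_cases hns : n ∈ s
      · have : A n = residueClass a n / n := by
          simp [hAdef, hp, B, hns]
        rw [this]
        have : 0 ≤ (x-1)⁻¹ * tl n := by positivity
        linarith
      · by_cases hcl : (n : ZMod q) = a
        · have h1 : tl n = 1 / n := by
            have : n ∈ S := ⟨hp, hcl⟩
            simp [tl, hns, hg, this]
          have h2 : residueClass a n = Real.log n := by
            simp [residueClass, hcl, vonMangoldt_apply_prime hp]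
          have h3 : 0 ≤ A n := by
            simp only [hAdef, hp, if_true, zero_div, zero_add]; exact hB0
          rw [h1, h2]
          have h4 := Real.log_le_rpow_div (x := (n:ℝ)) (by positivity) hx1
          have h5 : (n : ℝ)^x = n^(x-1) * n := by
            rw [← Real.rpow_add_one (by positivity)]; ring_nf
          have h6 : Real.log n / (n : ℝ)^x ≤ (x-1)⁻¹ * (1 / n) := by
            rw [h5, div_le_iff₀ (by positivity)]
            calc Real.log n ≤ (n:ℝ)^(x-1) / (x-1) := h4
              _ = _ := by field_simp
          linarith
        · have h2 : residueClass a n = 0 := by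
            simp [residueClass, hcl]
          rw [h2, zero_div]
          have h3 : 0 ≤ A n := by
            simp only [hAdef, hp, if_true, zero_div, zero_add]; exact hB0
          positivity
    · have : A n = residueClass a n / n + B n := by simp [hAdef, hp]
      rw [this]
      have : 0 ≤ (x-1)⁻¹ * tl n := by positivity
      linarith
  have main : ∀ x : ℝ, x ∈ Set.Ioc 1 2 → c / (x - 1) - C ≤ ∑' n, A n + (x-1)⁻¹ * (c/2) := by
    intro x hx
    have hx1 : 0 < x - 1 := by linarith [hx.1]
    refine (hC hx).trans ?_
    have hsum : Summable (fun n => A n + (x-1)⁻¹ * tl n) := hA.add (htl.mul_left _)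
    have := Summable.tsum_le_tsum (key x hx.1)
      (LSeries.summable_real_of_abscissaOfAbsConv_lt <|
        (abscissaOfAbsConv_residueClass_le_one a).trans_lt <| mod_cast hx.1) hsum
    refine this.trans ?_
    rw [hA.tsum_add (htl.mul_left _), tsum_mul_left]
    have : (x-1)⁻¹ * ∑' n, tl n ≤ (x-1)⁻¹ * (c/2) := by gcongr
    linarith
  obtain ⟨k, hk⟩ := exists_nat_gt ((∑' n, A n + C) / (c/2))
  rw [div_lt_iff₀ (half_pos hc)] at hk
  have h := main (1 + ((k:ℝ)+1)⁻¹) ⟨by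
      have : 0 < ((k:ℝ)+1)⁻¹ := by positivity
      linarith, by
      have : ((k:ℝ)+1)⁻¹ ≤ 1 := inv_le_one_of_one_le₀ (by linarith [(Nat.cast_nonneg k : (0:ℝ) ≤ k)])
      linarith⟩
  rw [show 1 + ((k:ℝ)+1)⁻¹ - 1 = ((k:ℝ)+1)⁻¹ by ring, inv_inv, div_inv_eq_mul] at h
  nlinarith

open Classical in
/-- `S` has upper density at most `c`. -/
def UDA (S : Set ℕ) (c : ℝ) : Prop :=
  ∀ ε : ℝ, 0 < ε → ∃ N0 : ℕ, ∀ N : ℕ, N0 ≤ N →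
    (((Finset.Icc 1 N).filter (· ∈ S)).card : ℝ) ≤ (c + ε) * N

lemma UDA_mono {S T : Set ℕ} {c : ℝ} (h : ∀ m, 0 < m → m ∈ S → m ∈ T) (hT : UDA T c) : UDA S c := by
  intro ε hε
  obtain ⟨N0, hN⟩ := hT ε hε
  refine ⟨N0, fun N hN0 => le_trans ?_ (hN N hN0)⟩
  norm_cast
  apply Finset.card_le_card
  intro m hm
  simp only [Finset.mem_filter, Finset.mem_Icc] at hm ⊢
  exact ⟨hm.1, h m (by omega) hm.2⟩

lemma UDA_union {S T : Set ℕ} {c d : ℝ} (hS : UDA S c) (hT : UDA T d) : UDA (S ∪ T) (c + d) := by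
  classical
  intro ε hε
  obtain ⟨N0, hN0⟩ := hS (ε/2) (by linarith)
  obtain ⟨N1, hN1⟩ := hT (ε/2) (by linarith)
  refine ⟨max N0 N1, fun N hN => ?_⟩
  have h1 := hN0 N (le_of_max_le_left hN)
  have h2 := hN1 N (le_of_max_le_right hN)
  have : (((Finset.Icc 1 N).filter (· ∈ S ∪ T)).card : ℝ) ≤
      ((Finset.Icc 1 N).filter (· ∈ S)).card + ((Finset.Icc 1 N).filter (· ∈ T)).card := by
    norm_cast
    refine le_trans (Finset.card_le_card ?_) (Finset.card_union_le _ _)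
    intro m hm
    simp only [Finset.mem_filter, Finset.mem_union, Set.mem_union] at hm ⊢
    tauto
  have h3 : (c + d + ε) * N = (c + ε/2) * N + (d + ε/2) * N := by ring
  rw [h3]
  convert! this.trans (add_le_add h1 h2) using 3
  ext; simp

lemma UDA_zero {S : Set ℕ} {c : ℝ} (h : ∀ ε : ℝ, 0 < ε → UDA S (c + ε)) : UDA S c := by
  intro ε hε
  obtain ⟨N0, hN⟩ := h (ε/2) (by linarith) (ε/2) (by linarith)
  refine ⟨N0, fun N hN0 => (hN N hN0).trans (le_of_eq (by ring))⟩

lemma UDA_of_bound {S : Set ℕ} {c B : ℝ}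
    (h : ∀ N : ℕ, ∀ T : Finset ℕ, (∀ m ∈ T, 1 ≤ m ∧ m ≤ N ∧ m ∈ S) → (T.card : ℝ) ≤ c * N + B) :
    UDA S c := by
  classical
  intro ε hε
  obtain ⟨N0, hN0⟩ := exists_nat_gt (B / ε)
  refine ⟨N0, fun N hN => ?_⟩
  rw [div_lt_iff₀ hε] at hN0
  have h1 := h N ((Finset.Icc 1 N).filter (· ∈ S)) (by
    intro m hm
    simp only [Finset.mem_filter, Finset.mem_Icc] at hm
    exact ⟨hm.1.1, hm.1.2, hm.2⟩)
  have : (N0 : ℝ) ≤ N := by exact_mod_cast hN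
  have : (N0 : ℝ) * ε ≤ N * ε := by gcongr
  convert! (h1.trans (show c * N + B ≤ (c + ε) * N by linarith)) using 1

lemma UDA_multiples {d : ℕ} (_hd : 0 < d) : UDA {m | d ∣ m} (1 / d) := by
  classical
  apply UDA_of_bound (B := 0)
  intro N T hT
  have : T.card ≤ N / d := by
    rw [← Nat.Ioc_filter_dvd_card_eq_div]
    apply Finset.card_le_card
    intro m hm
    obtain ⟨h1, h2, h3⟩ := hT m hm
    simp only [Finset.mem_filter, Finset.mem_Ioc]
    exact ⟨⟨h1, h2⟩, h3⟩
  calc (T.card : ℝ) ≤ ((N / d : ℕ) : ℝ) := by exact_mod_cast this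
    _ ≤ N / d := Nat.cast_div_le
    _ = _ := by ring

lemma sieveA {S : Set ℕ} (hp : ∀ p ∈ S, p.Prime)
    (hS : ¬ Summable (Set.indicator S (fun n : ℕ => (1 : ℝ) / n))) (ε : ℝ) (hε : 0 < ε) :
    ∃ P : Finset ℕ, (∀ p ∈ P, p ∈ S) ∧ UDA {m | ∀ p ∈ P, ¬ p ∣ m} ε := by
  classical
  rw [not_summable_iff_tendsto_nat_atTop_of_nonneg
    (fun n => Set.indicator_nonneg (fun _ _ => by positivity) _)] at hS
  obtain ⟨M, hM⟩ := (hS.eventually (Filter.eventually_ge_atTop (-Real.log ε))).exists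
  set P := (Finset.range M).filter (· ∈ S) with hP
  have hPS : ∀ p ∈ P, p ∈ S := by intro p h; simp [hP] at h; exact h.2
  have hPp : ∀ p ∈ P, p.Prime := fun p h => hp p (hPS p h)
  refine ⟨P, hPS, ?_⟩
  have hsum : -Real.log ε ≤ ∑ p ∈ P, (1:ℝ)/p := by
    refine hM.trans (le_of_eq ?_)
    rw [hP, Finset.sum_filter]
    apply Finset.sum_congr rfl
    intro i _
    simp [Set.indicator_apply]
  set Q := ∏ p ∈ P, p with hQ
  have hQ0 : Q ≠ 0 := Finset.prod_ne_zero_iff.2 (fun p h => (hPp p h).ne_zero)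
  have hQP : Q.primeFactors = P := Nat.primeFactors_prod hPp
  have htot : (Q.totient : ℝ) = Q * ∏ p ∈ P, (1 - (p : ℝ)⁻¹) := by
    have := Nat.totient_eq_mul_prod_factors Q
    rw [hQP] at this
    have h2 := congrArg (Rat.cast : ℚ → ℝ) this
    push_cast at h2
    exact h2
  have hprod : ∏ p ∈ P, (1 - (p : ℝ)⁻¹) ≤ ε := by
    calc ∏ p ∈ P, (1 - (p : ℝ)⁻¹) ≤ ∏ p ∈ P, Real.exp (-(1 / (p:ℝ))) := by
          apply Finset.prod_le_prod
          · intro p h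
            have : (1:ℝ) ≤ p := by exact_mod_cast (hPp p h).one_lt.le
            have := inv_le_one_of_one_le₀ this
            linarith
          · intro p h
            have := Real.add_one_le_exp (-(1 / (p:ℝ)))
            rw [one_div] at this ⊢
            linarith
      _ = Real.exp (-∑ p ∈ P, 1 / (p:ℝ)) := by rw [← Real.exp_sum, Finset.sum_neg_distrib]
      _ ≤ Real.exp (Real.log ε) := by apply Real.exp_le_exp.2; linarith
      _ = ε := Real.exp_log hε
  apply UDA_of_bound (B := Q.totient)
  intro N T hT
  have hcard : T.card ≤ Q.totient * (N / Q + 1) := by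
    refine le_trans (Finset.card_le_card ?_) (Nat.Ico_filter_coprime_le 1 N hQ0)
    intro m hm
    obtain ⟨h1, h2, h3⟩ := hT m hm
    simp only [Finset.mem_filter, Finset.mem_Ico]
    refine ⟨by omega, ?_⟩
    rw [hQ]
    apply Nat.Coprime.prod_left
    intro p hp'
    exact (Nat.Prime.coprime_iff_not_dvd (hPp p hp')).2 (h3 p hp')
  have hQr : (0:ℝ) < Q := by exact_mod_cast Nat.pos_of_ne_zero hQ0
  have h1 : (T.card : ℝ) ≤ Q.totient * ((N / Q : ℕ) + 1) := by exact_mod_cast hcard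
  have h2 : ((N / Q : ℕ) : ℝ) ≤ N / Q := Nat.cast_div_le
  calc (T.card : ℝ) ≤ Q.totient * ((N / Q : ℕ) + 1) := h1
    _ ≤ Q.totient * (N / Q + 1) := by gcongr
    _ = (∏ p ∈ P, (1 - (p : ℝ)⁻¹)) * N + Q.totient := by rw [mul_add, htot]; field_simp
    _ ≤ _ := by gcongr

open Classical in
lemma fewA (k : ℕ) : ∀ S : Set ℕ, (∀ p ∈ S, p.Prime) →
    ¬ Summable (Set.indicator S (fun n : ℕ => (1 : ℝ) / n)) →
    UDA {m | (m.primeFactors.filter (· ∈ S)).card < k} 0 := by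
  induction k with
  | zero =>
    intro S _ _
    apply UDA_of_bound (B := 0)
    intro N T hT
    have : T = ∅ := by
      apply Finset.eq_empty_of_forall_notMem
      intro m hm
      have := (hT m hm).2.2
      simp at this
    simp [this]
  | succ k ih =>
    intro S hp hS
    apply UDA_zero
    intro ε hε
    obtain ⟨P, hPS, hP⟩ := sieveA hp hS ε hε
    have hS' : ¬ Summable (Set.indicator (S \ (P : Set ℕ)) (fun n : ℕ => (1 : ℝ) / n)) := by
      intro h
      apply hS
      have hf : Summable (Set.indicator (P : Set ℕ) (fun n : ℕ => (1 : ℝ) / n)) := by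
        apply summable_of_ne_finset_zero (s := P)
        intro b hb
        exact Set.indicator_of_notMem (by simpa using hb) _
      convert h.add hf using 1
      ext n
      by_cases h1 : n ∈ P
      · have h2 := hPS n h1
        simp [h1, h2]
      · simp [Set.indicator_apply, h1]
    have h1 := ih _ (fun p h => hp p h.1) hS'
    refine UDA_mono ?_ (UDA_union h1 hP)
    intro m hm hmem
    by_contra hcon
    simp only [Set.mem_union, Set.mem_ofPred_eq, not_or, not_lt, not_forall, not_not] at hcon hmem
    obtain ⟨h2, p, hpP, hpm⟩ := hcon
    have : insert p (m.primeFactors.filter (· ∈ S \ (P : Set ℕ))) ⊆ m.primeFactors.filter (· ∈ S) := by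
      intro r hr
      rw [Finset.mem_insert] at hr
      rcases hr with rfl | hr
      · exact Finset.mem_filter.2 ⟨Nat.mem_primeFactors.2 ⟨hp _ (hPS _ hpP), hpm, hm.ne'⟩, hPS _ hpP⟩
      · rw [Finset.mem_filter] at hr ⊢
        exact ⟨hr.1, hr.2.1⟩
    have h3 := Finset.card_le_card this
    rw [Finset.card_insert_of_notMem (by simp [hpP])] at h3
    have h2' : k ≤ (m.primeFactors.filter (· ∈ S \ (P : Set ℕ))).card := by convert! h2
    omega

section FieldPart


open Polynomial NumberField

noncomputable def fA : ℤ[X] := X^3 + C 3 * X - C 1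

lemma fA_monic : fA.Monic := by
  unfold fA; monicity!

lemma fA_noroot : ∀ x : ZMod 2, ¬ (x^3 + 3 * x - 1 = 0) := by decide

lemma fA_irr : Irreducible (fA.map (algebraMap ℤ ℚ)) := by
  rw [← Polynomial.Monic.irreducible_iff_irreducible_map_fraction_map fA_monic]
  apply Polynomial.Monic.irreducible_of_irreducible_map (Int.castRingHom (ZMod 2)) _ fA_monic
  have hm := fA_monic.map (Int.castRingHom (ZMod 2))
  have hdeg : (fA.map (Int.castRingHom (ZMod 2))).natDegree = 3 := by
    rw [fA_monic.natDegree_map]; unfold fA; compute_degree!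
  have : Fact (Nat.Prime 2) := ⟨Nat.prime_two⟩
  rw [Polynomial.irreducible_iff_roots_eq_zero_of_degree_le_three (by omega) (by omega)]
  rw [Multiset.eq_zero_iff_forall_notMem]
  intro x hx
  have hx := isRoot_of_mem_roots hx
  simp only [fA, IsRoot.def, Polynomial.map_sub, Polynomial.map_add, Polynomial.map_mul,
    Polynomial.map_pow, map_X, map_C, eval_sub, eval_add, eval_mul, eval_pow, eval_X, eval_C] at hx
  refine fA_noroot x ?_
  simpa using hx

lemma fieldA : ∃ (K : Type) (_ : Field K) (_ : NumberField K) (θ : 𝓞 K) (d : ℤ), d ≠ 0 ∧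
    (∀ x : 𝓞 K, ∃ g : ℤ[X], (d : 𝓞 K) * x = aeval θ g) ∧
    (∀ g : ℤ[X], aeval θ g = 0 → fA ∣ g) := by
  have hirr : Fact (Irreducible (fA.map (algebraMap ℤ ℚ))) := ⟨fA_irr⟩
  have hmon : (fA.map (algebraMap ℤ ℚ)).Monic := fA_monic.map _
  let K := AdjoinRoot (fA.map (algebraMap ℤ ℚ))
  let B : PowerBasis ℚ K := AdjoinRoot.powerBasis hirr.out.ne_zero
  have hfd : FiniteDimensional ℚ K := B.finite
  have hcz : CharZero K := charZero_of_injective_algebraMap (algebraMap ℚ K).injective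
  have hnf : NumberField K := { to_charZero := hcz, to_finiteDimensional := by convert! hfd }
  have hev : ∀ g : ℤ[X], aeval B.gen g = AdjoinRoot.mk (fA.map (algebraMap ℤ ℚ)) (g.map (algebraMap ℤ ℚ)) := by
    intro g
    have : B.gen = AdjoinRoot.root (fA.map (algebraMap ℤ ℚ)) := AdjoinRoot.powerBasis_gen _
    rw [this, ← AdjoinRoot.aeval_eq, aeval_map_algebraMap]
  have hker : ∀ g : ℤ[X], aeval B.gen g = 0 → fA ∣ g := by
    intro g hg
    rw [hev, AdjoinRoot.mk_eq_zero] at hg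
    exact (Polynomial.map_dvd_map (algebraMap ℤ ℚ) (algebraMap ℤ ℚ).injective_int fA_monic).1 hg
  have hBint : IsIntegral ℤ B.gen := by
    refine ⟨fA, fA_monic, ?_⟩
    rw [← aeval_def, hev, AdjoinRoot.mk_self]
  have hdint : IsIntegral ℤ (Algebra.discr ℚ B.basis) := by
    apply Algebra.discr_isIntegral
    intro i
    rw [PowerBasis.coe_basis]
    exact hBint.pow _
  obtain ⟨d, hd⟩ := IsIntegrallyClosed.isIntegral_iff.1 hdint
  have hd0 : d ≠ 0 := by
    rintro rfl
    apply Algebra.discr_not_zero_of_basis ℚ B.basis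
    rw [← hd]; simp
  obtain ⟨θ, hθ⟩ : ∃ θ : 𝓞 K, algebraMap (𝓞 K) K θ = B.gen := ⟨⟨B.gen, hBint⟩, rfl⟩
  have h2 : ∀ g : ℤ[X], algebraMap (𝓞 K) K (aeval θ g) = aeval B.gen g := by
    intro g
    rw [← hθ]
    exact (aeval_algebraMap_apply K θ g).symm
  refine ⟨K, inferInstance, hnf, θ, d, hd0, ?_, ?_⟩
  · intro x
    have h1 := Algebra.discr_mul_isIntegral_mem_adjoin ℚ hBint (RingOfIntegers.isIntegral_coe x)
    rw [Algebra.adjoin_singleton_eq_range_aeval, ← hd] at h1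
    obtain ⟨g, hg⟩ := h1
    refine ⟨g, ?_⟩
    apply RingOfIntegers.ext
    refine Eq.trans (Eq.trans ?_ hg.symm) (h2 g).symm
    simp [Algebra.smul_def]
  · intro g hg
    apply hker
    rw [← h2 g, hg]; simp

section
variable {K : Type} [Field K] [NumberField K] (θ : 𝓞 K) (d : ℤ)

/-- ideal attached to a root. -/
noncomputable def JA (m t : ℕ) : Ideal (𝓞 K) := Ideal.span {(m : 𝓞 K), θ - (t : 𝓞 K)}

lemma JA_int (h1 : ∀ x : 𝓞 K, ∃ g : ℤ[X], (d : 𝓞 K) * x = aeval θ g)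
    (h2 : ∀ g : ℤ[X], aeval θ g = 0 → fA ∣ g) {m t : ℕ}
    (ht : (t : ZMod m)^3 + 3 * (t : ZMod m) - 1 = 0) {c : ℕ} (hc : (c : 𝓞 K) ∈ JA θ m t) :
    (m : ℤ) ∣ d * c := by
  rw [JA, Ideal.mem_span_pair] at hc
  obtain ⟨x, y, hxy⟩ := hc
  obtain ⟨g1, hg1⟩ := h1 x
  obtain ⟨g2, hg2⟩ := h1 y
  have h0 : aeval θ (C (d * c) - g1 * C (m : ℤ) - g2 * (X - C (t : ℤ))) = 0 := by
    simp only [map_sub, map_mul, aeval_C, aeval_X, ← hg1, ← hg2]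
    simp only [algebraMap_int_eq, eq_intCast, Int.cast_natCast]
    rw [← hxy]; ring
  obtain ⟨q, hq⟩ := h2 _ h0
  have := congrArg (fun g : ℤ[X] => g.eval₂ (Int.castRingHom (ZMod m)) (t : ZMod m)) hq
  simp only [eval₂_sub, eval₂_mul, eval₂_C, eval₂_X, fA, eval₂_add, eval₂_pow] at this
  simp only [eq_intCast, Int.cast_mul, Int.cast_natCast, CharP.cast_eq_zero, Int.cast_ofNat, Int.cast_one, ht] at this
  rw [← ZMod.intCast_zmod_eq_zero_iff_dvd]
  push_cast
  linear_combination this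

lemma JA_norm (hd : d ≠ 0) (h1 : ∀ x : 𝓞 K, ∃ g : ℤ[X], (d : 𝓞 K) * x = aeval θ g)
    {m t : ℕ} (hm : 0 < m) :
    Ideal.absNorm (JA θ m t) ≤ m * Ideal.absNorm (Ideal.span {(d : 𝓞 K)}) := by
  have hne : NeZero m := ⟨hm.ne'⟩
  set D := Ideal.span {(d : 𝓞 K)} with hD
  have hD0 : D ≠ ⊥ := by
    rw [hD, Ne, Ideal.span_singleton_eq_bot]
    exact_mod_cast hd
  have hfin : Finite (𝓞 K ⧸ D) := Ideal.finiteQuotientOfFreeOfNeBot D hD0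
  have hθ : ∀ g : ℤ[X], ∃ z : ℤ, (Ideal.Quotient.mk (JA θ m t)) (aeval θ g) = z := by
    intro g
    refine ⟨g.eval (t : ℤ), ?_⟩
    have hmem : θ - (t : 𝓞 K) ∈ JA θ m t := Ideal.subset_span (by simp)
    have he : (Ideal.Quotient.mk (JA θ m t)) θ = (t : 𝓞 K ⧸ JA θ m t) := by
      rw [← map_natCast (Ideal.Quotient.mk (JA θ m t)) t, Ideal.Quotient.eq]
      exact hmem
    rw [aeval_def, hom_eval₂, he]
    have := Polynomial.hom_eval₂ g (RingHom.id ℤ) (Int.castRingHom (𝓞 K ⧸ JA θ m t)) (t : ℤ)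
    rw [eval₂_id] at this
    simp only [eq_intCast, Int.cast_natCast] at this
    rw [this]
    congr 1
  have hm0 : ((m : ℕ) : 𝓞 K ⧸ JA θ m t) = 0 := by
    rw [← map_natCast (Ideal.Quotient.mk (JA θ m t)) m, Ideal.Quotient.eq_zero_iff_mem]
    exact Ideal.subset_span (by simp)
  rw [Ideal.absNorm_apply, Ideal.absNorm_apply, Submodule.cardQuot_apply, Submodule.cardQuot_apply]
  have hcard : m * Nat.card (𝓞 K ⧸ D) = Nat.card (Fin m × (𝓞 K ⧸ D)) := by simp
  change Nat.card (𝓞 K ⧸ JA θ m t) ≤ m * Nat.card (𝓞 K ⧸ D)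
  rw [hcard]
  let F : Fin m × (𝓞 K ⧸ D) → 𝓞 K ⧸ JA θ m t := fun x =>
    ((x.1 : ℕ) : 𝓞 K ⧸ JA θ m t) + Ideal.Quotient.mk (JA θ m t) (Quotient.out x.2)
  apply Nat.card_le_card_of_surjective F
  intro y
  obtain ⟨x, rfl⟩ := Ideal.Quotient.mk_surjective y
  set r : 𝓞 K ⧸ D := Ideal.Quotient.mk D x with hr
  have h3 : Ideal.Quotient.mk D x = Ideal.Quotient.mk D (Quotient.out r) := by
    rw [← hr]; exact (Quotient.out_eq r).symm
  rw [Ideal.Quotient.eq] at h3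
  obtain ⟨w, hw⟩ := Ideal.mem_span_singleton.1 (show x - Quotient.out r ∈ Ideal.span {(d : 𝓞 K)} from h3)
  obtain ⟨g, hg⟩ := h1 w
  obtain ⟨z, hz⟩ := hθ g
  have hmz : (0:ℤ) < m := by exact_mod_cast hm
  refine ⟨(⟨(z % m).toNat, by have := Int.emod_lt_of_pos z hmz; have := Int.emod_nonneg z hmz.ne'; omega⟩, r), ?_⟩
  simp only [F]
  have h4 : (((z % m).toNat : ℕ) : 𝓞 K ⧸ JA θ m t) = z := by
    rw [← Int.cast_natCast, Int.toNat_of_nonneg (Int.emod_nonneg z hmz.ne')]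
    conv_rhs => rw [← Int.emod_add_mul_ediv z m]
    push_cast
    rw [hm0]; ring
  rw [h4, ← hz, ← map_add, ← hg, ← hw]
  congr 1; ring

lemma countA (hd : d ≠ 0) (h1 : ∀ x : 𝓞 K, ∃ g : ℤ[X], (d : 𝓞 K) * x = aeval θ g)
    (h2 : ∀ g : ℤ[X], aeval θ g = 0 → fA ∣ g) (N : ℕ) (s : ℝ)
    (hs : (N : ℝ) * Ideal.absNorm (Ideal.span {(d : 𝓞 K)}) ≤ s) :
    ∑ m ∈ Finset.Icc 1 N, rhoA m ≤
      Nat.card {I : Ideal (𝓞 K) // (Ideal.absNorm I : ℝ) ≤ s} * ((d.natAbs + 1) * (d.natAbs + 1)) := by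
  have hne : ∀ m : Finset.Icc 1 N, NeZero (m : ℕ) := fun m => ⟨by
    have := (Finset.mem_Icc.1 m.2).1; omega⟩
  have hfin : Finite {I : Ideal (𝓞 K) // (Ideal.absNorm I : ℝ) ≤ s} := by
    have := Ideal.finite_setOfPred_absNorm_le (S := 𝓞 K) ⌊s⌋₊
    apply Set.Finite.to_subtype (s := {I : Ideal (𝓞 K) | (Ideal.absNorm I : ℝ) ≤ s})
    refine this.subset ?_
    intro I hI
    exact Nat.le_floor hI
  have hL : ∑ m ∈ Finset.Icc 1 N, rhoA m =
      Nat.card (Σ m : Finset.Icc 1 N, {t : ZMod m // t^3 + 3 * t - 1 = 0}) := by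
    rw [Nat.card_sigma, ← Finset.sum_coe_sort]; rfl
  have hR : Nat.card {I : Ideal (𝓞 K) // (Ideal.absNorm I : ℝ) ≤ s} * ((d.natAbs + 1) * (d.natAbs + 1))
      = Nat.card ({I : Ideal (𝓞 K) // (Ideal.absNorm I : ℝ) ≤ s} × (Fin (d.natAbs + 1) × Fin (d.natAbs + 1))) := by
    simp
  rw [hL, hR]
  let c : Ideal (𝓞 K) → ℕ := fun I => ringChar (𝓞 K ⧸ I)
  have hcs : ∀ (I : Ideal (𝓞 K)) (k : ℕ), (k : 𝓞 K) ∈ I ↔ c I ∣ k := by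
    intro I k
    rw [← ringChar.spec, ← map_natCast (Ideal.Quotient.mk I) k, Ideal.Quotient.eq_zero_iff_mem]
  have hbd : ∀ m t : ℕ, 0 < m → (t : ZMod m)^3 + 3 * (t : ZMod m) - 1 = 0 →
      c (JA θ m t) ∣ m ∧ m / c (JA θ m t) ≤ d.natAbs := by
    intro m t hm ht
    have hcm : c (JA θ m t) ∣ m := (hcs _ _).1 (Ideal.subset_span (by simp))
    refine ⟨hcm, ?_⟩
    have h3 := JA_int θ d h1 h2 ht ((hcs _ _).2 dvd_rfl)
    have h4 : m ∣ d.natAbs * c (JA θ m t) := by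
      have := Int.natAbs_dvd_natAbs.2 h3
      simpa [Int.natAbs_mul] using this
    have hc0 : 0 < c (JA θ m t) := Nat.pos_of_dvd_of_pos hcm hm
    have hd0 : 0 < d.natAbs := Int.natAbs_pos.2 hd
    have h5 := Nat.le_of_dvd (by positivity) h4
    exact Nat.div_le_of_le_mul (by linarith [mul_comm d.natAbs (c (JA θ m t))])
  have hval : ∀ (m : Finset.Icc 1 N) (t : ZMod m), t^3 + 3 * t - 1 = 0 →
      ((t.val : ℕ) : ZMod m)^3 + 3 * ((t.val : ℕ) : ZMod m) - 1 = 0 := by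
    intro m t ht
    have := hne m
    rw [ZMod.natCast_zmod_val]; exact ht
  let F : (Σ m : Finset.Icc 1 N, {t : ZMod m // t^3 + 3 * t - 1 = 0}) →
      {I : Ideal (𝓞 K) // (Ideal.absNorm I : ℝ) ≤ s} × (Fin (d.natAbs + 1) × Fin (d.natAbs + 1)) :=
    fun x => (⟨JA θ x.1 x.2.1.val, by
        have hx := Finset.mem_Icc.1 x.1.2
        have h3 := JA_norm θ d hd h1 (m := x.1) (t := x.2.1.val) hx.1
        have h4 : Ideal.absNorm (JA θ x.1 x.2.1.val) ≤ N * Ideal.absNorm (Ideal.span {(d : 𝓞 K)}) :=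
          h3.trans (Nat.mul_le_mul_right _ hx.2)
        refine le_trans ?_ hs
        exact_mod_cast h4⟩,
      (⟨x.1 / c (JA θ x.1 x.2.1.val), by
        have hx := Finset.mem_Icc.1 x.1.2
        have := (hbd x.1 x.2.1.val hx.1 (hval _ _ x.2.2)).2
        omega⟩,
       ⟨x.2.1.val / c (JA θ x.1 x.2.1.val), by
        have hx := Finset.mem_Icc.1 x.1.2
        have h3 := (hbd x.1 x.2.1.val hx.1 (hval _ _ x.2.2)).2
        have := hne x.1
        have h4 := ZMod.val_lt x.2.1
        have h5 := Nat.div_le_div_right (c := c (JA θ x.1 x.2.1.val)) h4.le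
        omega⟩))
  apply Nat.card_le_card_of_injective F
  rintro ⟨⟨m, hm⟩, ⟨t, ht⟩⟩ ⟨⟨m', hm'⟩, ⟨t', ht'⟩⟩ heq
  simp only [F, Prod.mk.injEq, Subtype.mk.injEq, Fin.mk.injEq] at heq
  obtain ⟨e1, e2, e3⟩ := heq
  have hmp := (Finset.mem_Icc.1 hm).1
  have hmp' := (Finset.mem_Icc.1 hm').1
  have b1 := (hbd m t.val hmp (hval ⟨m, hm⟩ t ht)).1
  have b2 := (hbd m' t'.val hmp' (hval ⟨m', hm'⟩ t' ht')).1
  have mem1 : θ - (t.val : 𝓞 K) ∈ JA θ m t.val := Ideal.subset_span (by simp)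
  have mem2 : θ - (t'.val : 𝓞 K) ∈ JA θ m' t'.val := Ideal.subset_span (by simp)
  rw [← e1] at e2 e3 b2 mem2
  have hmm : m = m' := by
    rw [← Nat.div_mul_cancel b1, e2, Nat.div_mul_cancel b2]
  subst hmm
  have hmod : t.val ≡ t'.val [MOD c (JA θ m t.val)] := by
    have h3 : ((t.val : ℕ) : 𝓞 K ⧸ JA θ m t.val) = (t'.val : ℕ) := by
      rw [← map_natCast (Ideal.Quotient.mk (JA θ m t.val)) t.val,
        ← map_natCast (Ideal.Quotient.mk (JA θ m t.val)) t'.val, Ideal.Quotient.eq]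
      have := Ideal.sub_mem _ mem2 mem1
      convert this using 1; ring
    exact (CharP.natCast_eq_natCast (𝓞 K ⧸ JA θ m t.val) (ringChar (𝓞 K ⧸ JA θ m t.val))).1 h3
  have htt : t.val = t'.val := by
    rw [← Nat.mod_add_div t.val (c (JA θ m t.val)), hmod, e3, Nat.mod_add_div]
  have := hne ⟨m, hm⟩
  have : t = t' := ZMod.val_injective m htt
  subst this
  rfl

end

lemma rhoA_sum : ∃ C : ℝ, 0 < C ∧ ∀ N : ℕ, ((∑ m ∈ Finset.Icc 1 N, rhoA m : ℕ) : ℝ) ≤ C * N := by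
  obtain ⟨K, _, _, θ, d, hd, h1, h2⟩ := fieldA
  have ht := NumberField.Ideal.tendsto_norm_le_div_atTop K
  set L := ((2 ^ InfinitePlace.nrRealPlaces K * (2 * Real.pi) ^ InfinitePlace.nrComplexPlaces K * Units.regulator K * classNumber K) /
        (Units.torsionOrder K * Real.sqrt |discr K|)) with hL
  obtain ⟨s0, hs0⟩ := Filter.eventually_atTop.1 (ht.eventually (gt_mem_nhds (lt_add_one L)))
  set D := Ideal.absNorm (Ideal.span {(d : 𝓞 K)}) with hD
  set S := max s0 1 with hS
  have hS1 : 1 ≤ S := le_max_right _ _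
  refine ⟨(|L + 1| + 1) * (D + S) * ((d.natAbs + 1) * (d.natAbs + 1)), by positivity, fun N => ?_⟩
  rcases Nat.eq_zero_or_pos N with rfl | hN
  · simp
  have hN1 : (1:ℝ) ≤ N := by exact_mod_cast hN
  have hDS : 0 < (D + S) * N := by positivity
  have hc := countA θ d hd h1 h2 N ((D + S) * N) (by rw [← hD]; nlinarith)
  have h3 := hs0 ((D + S) * N) (by
    have : s0 ≤ S := le_max_left _ _
    have : (0:ℝ) ≤ D := by positivity
    nlinarith)
  rw [div_lt_iff₀ hDS] at h3
  have hc' : ((∑ m ∈ Finset.Icc 1 N, rhoA m : ℕ) : ℝ) ≤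
    (Nat.card {I : Ideal (𝓞 K) // (Ideal.absNorm I : ℝ) ≤ (D + S) * N} : ℝ) * ((d.natAbs + 1) * (d.natAbs + 1)) := by
    exact_mod_cast hc
  refine hc'.trans ?_
  have h4 : (L + 1) * ((D + S) * N) ≤ (|L + 1| + 1) * ((D + S) * N) := by
    gcongr; linarith [le_abs_self (L+1)]
  calc _ ≤ ((|L + 1| + 1) * ((D + S) * N)) * ((d.natAbs + 1) * (d.natAbs + 1)) := by
        gcongr; exact h3.le.trans h4
    _ = _ := by ring

end FieldPart

lemma fewA_free (k : ℕ) (S : Set ℕ) (hp : ∀ p ∈ S, p.Prime)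
    (hS : ¬ Summable (Set.indicator S (fun n : ℕ => (1 : ℝ) / n))) :
    UDA {m | ∀ T : Finset ℕ, T ⊆ m.primeFactors → (∀ p ∈ T, p ∈ S) → T.card < k} 0 := by
  classical
  refine UDA_mono ?_ (fewA k S hp hS)
  intro m _ hm
  exact hm _ (Finset.filter_subset _ _) (fun p hp => (Finset.mem_filter.1 hp).2)

lemma UDA_rho {C : ℝ} (hC : ∀ N : ℕ, ((∑ m ∈ Finset.Icc 1 N, rhoA m : ℕ) : ℝ) ≤ C * N) (k : ℕ) :
    UDA {m | 3 ^ k ≤ rhoA m} (C / 3 ^ k) := by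
  apply UDA_of_bound (B := 0)
  intro N T hT
  have h1 : T.card * 3 ^ k ≤ ∑ m ∈ T, rhoA m := by
    rw [← smul_eq_mul]
    exact Finset.card_nsmul_le_sum _ _ _ (fun m hm => (hT m hm).2.2)
  have h2 : ∑ m ∈ T, rhoA m ≤ ∑ m ∈ Finset.Icc 1 N, rhoA m :=
    Finset.sum_le_sum_of_subset (fun m hm => Finset.mem_Icc.2 ⟨(hT m hm).1, (hT m hm).2.1⟩)
  have h3 : ((T.card * 3 ^ k : ℕ) : ℝ) ≤ C * N := le_trans (by exact_mod_cast h1.trans h2) (hC N)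
  push_cast at h3
  rw [add_zero, div_mul_eq_mul_div, le_div_iff₀ (by positivity)]
  exact h3

lemma UDA_fifteen (k : ℕ) :
    UDA {m | (m.primeFactors.filter (fun p => p % 15 = 1)).card < k} 0 := by
  classical
  refine UDA_mono ?_ (fewA_free k {p : ℕ | p.Prime ∧ (p : ZMod 15) = 1} (fun p hp => hp.1)
    (primesA_not_summable (q := 15) isUnit_one))
  intro m _ hm T hT hTS
  refine lt_of_le_of_lt (Finset.card_le_card ?_) hm
  intro p hp
  rw [Finset.mem_filter]
  refine ⟨hT hp, ?_⟩
  have h2 : ((p : ℕ) : ZMod 15) = ((1 : ℕ) : ZMod 15) := by simpa using (hTS p hp).2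
  rw [ZMod.natCast_eq_natCast_iff'] at h2
  simpa using h2

lemma UDA_class (K : ℕ) (hK : 2 ≤ K) :
    UDA {m | ∀ p : ℕ, p.Prime → p ∣ m → p % 5 = 2 → ¬ 2 ^ K ∣ p + 1} 0 := by
  classical
  have hco : Nat.Coprime 5 (2 ^ K) := Nat.Coprime.pow_right _ (by norm_num)
  obtain ⟨r, hr1, hr2⟩ := Nat.chineseRemainder hco 2 (2 ^ K - 1)
  have hpos : 1 ≤ 2 ^ K := Nat.one_le_two_pow
  have hne : NeZero (5 * 2 ^ K) := ⟨by positivity⟩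
  have hr3 : 2 ^ K ∣ r + 1 := by
    have h1 : r + 1 ≡ 2 ^ K - 1 + 1 [MOD 2 ^ K] := hr2.add_right 1
    rw [Nat.sub_add_cancel hpos] at h1
    exact (Nat.modEq_zero_iff_dvd).1 (h1.trans (by simp [Nat.ModEq]))
  have hodd : ¬ 2 ∣ r := by
    have : 2 ∣ r + 1 := (dvd_pow_self 2 (by omega)).trans hr3
    omega
  have h5 : ¬ 5 ∣ r := by
    have : r % 5 = 2 % 5 := hr1
    omega
  have hu : IsUnit ((r : ℕ) : ZMod (5 * 2 ^ K)) := by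
    rw [ZMod.isUnit_iff_coprime]
    apply Nat.Coprime.mul_right
    · exact ((Nat.Prime.coprime_iff_not_dvd Nat.prime_five).2 h5).symm
    · exact Nat.Coprime.pow_right _ ((Nat.Prime.coprime_iff_not_dvd Nat.prime_two).2 hodd).symm
  have h := fewA_free 1 {p : ℕ | p.Prime ∧ (p : ZMod (5 * 2 ^ K)) = r} (fun p hp => hp.1)
    (primesA_not_summable hu)
  refine UDA_mono ?_ h
  intro m hm0 hm T hT hTS
  rw [Nat.lt_one_iff, Finset.card_eq_zero, Finset.eq_empty_iff_forall_notMem]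
  intro p hpT
  obtain ⟨hpp, hpr⟩ := hTS p hpT
  have hp := hT hpT
  have hpm : p ≡ r [MOD 5 * 2 ^ K] := (ZMod.natCast_eq_natCast_iff _ _ _).1 hpr
  refine hm p hpp (Nat.dvd_of_mem_primeFactors hp) ?_ ?_
  · exact (hpm.of_mul_right _).trans hr1
  · have h1 : p + 1 ≡ r + 1 [MOD 2 ^ K] := (hpm.of_mul_left _).add_right 1
    exact (Nat.modEq_zero_iff_dvd).1 (h1.trans ((Nat.modEq_zero_iff_dvd).2 hr3))

lemma Afib_UDA : UDA Afib 0 := by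
  apply UDA_zero
  intro ε hε
  obtain ⟨C, hC0, hC⟩ := rhoA_sum
  obtain ⟨K, hK⟩ := exists_pow_lt_of_lt_one (show 0 < ε / 2 by positivity) (show (1/2 : ℝ) < 1 by norm_num)
  obtain ⟨k, hk⟩ := exists_pow_lt_of_lt_one (show 0 < ε / 2 / C by positivity) (show (1/3 : ℝ) < 1 by norm_num)
  have hU := UDA_union (UDA_union (UDA_class (K + 2) (by omega)) (UDA_multiples (d := 2 ^ (K + 2)) (by positivity)))
    (UDA_union (UDA_fifteen k) (UDA_rho hC k))
  have hle : (0 + 1 / ((2 ^ (K + 2) : ℕ) : ℝ)) + (0 + C / 3 ^ k) ≤ 0 + ε := by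
    have h1 : 1 / ((2 ^ (K + 2) : ℕ) : ℝ) ≤ (1/2) ^ K := by
      rw [one_div_pow]
      push_cast
      apply one_div_le_one_div_of_le (by positivity)
      exact pow_le_pow_right₀ (by norm_num) (by omega)
    have h2 : C / 3 ^ k ≤ ε / 2 := by
      rw [lt_div_iff₀ hC0] at hk
      have : C / 3 ^ k = (1/3 : ℝ) ^ k * C := by rw [one_div_pow]; ring
      linarith
    linarith
  have hU2 : UDA Afib ((0 + 1 / ((2 ^ (K + 2) : ℕ) : ℝ)) + (0 + C / 3 ^ k)) := by
    refine UDA_mono ?_ hU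
    rintro m hm ⟨n, hn, rfl⟩
    have hdn : gf n ∣ n := Nat.gcd_dvd_left _ _
    have hdf : gf n ∣ Nat.fib n := Nat.gcd_dvd_right _ _
    by_cases hc : ∀ p : ℕ, p.Prime → p ∣ gf n → p % 5 = 2 → ¬ 2 ^ (K + 2) ∣ p + 1
    · exact Or.inl (Or.inl hc)
    push Not at hc
    obtain ⟨p, hp, hpm, hp5, hp2⟩ := hc
    have h2n : 2 ^ (K + 2) ∣ n := fibA_two_adic (by omega) hp hp5 hp2 (hpm.trans hdf)
    by_cases h3 : 3 ∣ n
    · left; right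
      have hco : Nat.Coprime 3 (2 ^ (K + 2)) := Nat.Coprime.pow_right _ (by norm_num)
      have h4 : 3 * 2 ^ (K + 2) ∣ n := hco.mul_dvd_of_dvd_of_dvd h3 h2n
      have h5 : 2 ^ (K + 2) ∣ Nat.fib n :=
        (pow_dvd_pow 2 (by omega)).trans ((fibA_two_pow (K + 2)).trans (Nat.fib_dvd _ _ h4))
      exact Nat.dvd_gcd h2n h5
    · right
      obtain ⟨t, ht⟩ := fibA_root hdf h3
      have hne : NeZero (gf n) := ⟨hm.ne'⟩
      have hpos : 1 ≤ rhoA (gf n) := by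
        have : Nonempty {t : ZMod (gf n) // t^3 + 3 * t - 1 = 0} := ⟨⟨t, ht⟩⟩
        exact Nat.card_pos
      have hlow := rhoA_lower (gf n) hm hpos
      by_cases hk2 : ((gf n).primeFactors.filter (fun p => p % 15 = 1)).card < k
      · exact Or.inl hk2
      · right
        exact (Nat.pow_le_pow_right (by norm_num) (not_lt.1 hk2)).trans hlow
  intro δ hδ
  obtain ⟨N0, hN0⟩ := hU2 δ hδ
  refine ⟨N0, fun N hN => (hN0 N hN).trans ?_⟩
  gcongr

theorem stmt14 :
    Filter.Tendsto
      (fun x : ℝ => (Nat.card {n : ℕ | n ∈ Afib ∧ (n : ℝ) ≤ x} : ℝ) / x)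
      Filter.atTop (nhds 0) := by
  classical
  rw [Metric.tendsto_atTop]
  intro ε hε
  obtain ⟨N0, hN0⟩ := Afib_UDA (ε / 2) (by positivity)
  refine ⟨max (N0 : ℝ) 1, fun x hx => ?_⟩
  have hx1 : 1 ≤ x := (le_max_right _ _).trans hx
  have hxN : (N0 : ℝ) ≤ x := (le_max_left _ _).trans hx
  have hb := hN0 ⌊x⌋₊ (Nat.le_floor hxN)
  have hle : (Nat.card {n : ℕ | n ∈ Afib ∧ (n : ℝ) ≤ x} : ℝ) ≤ (0 + ε / 2) * (⌊x⌋₊ : ℝ) := by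
    refine le_trans ?_ hb
    rw [Nat.card_coe_set_eq, ← Set.ncard_coe_finset, Nat.cast_le]
    apply Set.ncard_le_ncard _ (Finset.finite_toSet _)
    rintro m ⟨hm, hmx⟩
    rw [Finset.mem_coe, Finset.mem_filter, Finset.mem_Icc]
    refine ⟨⟨?_, Nat.le_floor hmx⟩, hm⟩
    obtain ⟨n, hn, rfl⟩ := hm
    exact Nat.gcd_pos_of_pos_left _ hn
  have hfl : (⌊x⌋₊ : ℝ) ≤ x := Nat.floor_le (by linarith)
  rw [Real.dist_eq, sub_zero, abs_of_nonneg (by positivity), div_lt_iff₀ (by linarith)]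
  nlinarith
end
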